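/- Classification of groupoids of type (4;2): let G be a groupoid with exactly 2 objects and exactly 4 morphisms in total. Then there exist objects u ≠ v of G such that exactly one of the following holds: (i) the hom-sets u ⟶ v and v ⟶ u are empty, u ⟶ u has exactly one element, and Aut v ≃* Multiplicative (ZMod 3) (G is isomorphic to the disjoint union {e} ⊔ ℤ₃); (ii) the hom-sets u ⟶ v and v ⟶ u are empty and Aut u ≃* Multiplicative (ZMod 2) and Aut v ≃* Multiplicative (ZMod 2) (G is isomorphic to ℤ₂ ⊔ ℤ₂); (iii) every hom-set of G has exactly one element (G is isomorphic to the pair groupoid on two objects, the groupoid F₍₄;₂₎(ℝ²) of saltus functions on the coordinate axes of a plane). -/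

import Mathlib

open CategoryTheory

theorem aut_card_aux {G : Type*} [Groupoid G] [∀ a b : G, Fintype (a ⟶ b)] (v : G) :
    Nat.card (Aut v) = Fintype.card (v ⟶ v) := by
  rw [← Nat.card_eq_fintype_card]
  exact Nat.card_congr (Groupoid.isoEquivHom v v)

theorem aut_equiv_iff_aux {G : Type*} [Groupoid G] [∀ a b : G, Fintype (a ⟶ b)] (v : G)
    (p : ℕ) [Fact p.Prime] :
    Nonempty (Aut v ≃* Multiplicative (ZMod p)) ↔ Fintype.card (v ⟶ v) = p := by
  have hz : Nat.card (Multiplicative (ZMod p)) = p := by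
    rw [Nat.card_congr Multiplicative.toAdd, Nat.card_zmod]
  constructor
  · rintro ⟨e⟩
    rw [← aut_card_aux, Nat.card_congr e.toEquiv, hz]
  · intro h
    exact ⟨mulEquivOfPrimeCardEq (p := p) ((aut_card_aux v).trans h) hz⟩

theorem groupoid_type_4_2_classification {G : Type*} [Groupoid G] [Fintype G]
    [∀ a b : G, Fintype (a ⟶ b)]
    (hobj : Fintype.card G = 2)
    (hcard : Fintype.card (Σ (a : G) (b : G), a ⟶ b) = 4) :
    ∃ u v : G, u ≠ v ∧
      ((IsEmpty (u ⟶ v) ∧ IsEmpty (v ⟶ u) ∧ Fintype.card (u ⟶ u) = 1 ∧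
          Nonempty (Aut v ≃* Multiplicative (ZMod 3))) ∧
        ¬(IsEmpty (u ⟶ v) ∧ IsEmpty (v ⟶ u) ∧
          Nonempty (Aut u ≃* Multiplicative (ZMod 2)) ∧
          Nonempty (Aut v ≃* Multiplicative (ZMod 2))) ∧
        ¬(∀ a b : G, Fintype.card (a ⟶ b) = 1) ∨
      ¬(IsEmpty (u ⟶ v) ∧ IsEmpty (v ⟶ u) ∧ Fintype.card (u ⟶ u) = 1 ∧
          Nonempty (Aut v ≃* Multiplicative (ZMod 3))) ∧
        (IsEmpty (u ⟶ v) ∧ IsEmpty (v ⟶ u) ∧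
          Nonempty (Aut u ≃* Multiplicative (ZMod 2)) ∧
          Nonempty (Aut v ≃* Multiplicative (ZMod 2))) ∧
        ¬(∀ a b : G, Fintype.card (a ⟶ b) = 1) ∨
      ¬(IsEmpty (u ⟶ v) ∧ IsEmpty (v ⟶ u) ∧ Fintype.card (u ⟶ u) = 1 ∧
          Nonempty (Aut v ≃* Multiplicative (ZMod 3))) ∧
        ¬(IsEmpty (u ⟶ v) ∧ IsEmpty (v ⟶ u) ∧
          Nonempty (Aut u ≃* Multiplicative (ZMod 2)) ∧
          Nonempty (Aut v ≃* Multiplicative (ZMod 2))) ∧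
        (∀ a b : G, Fintype.card (a ⟶ b) = 1)) := by
  haveI : Fact (Nat.Prime 2) := ⟨Nat.prime_two⟩
  haveI : Fact (Nat.Prime 3) := ⟨Nat.prime_three⟩
  classical
  simp only [aut_equiv_iff_aux, ← Fintype.card_eq_zero_iff]
  obtain ⟨u, v, huv, huniv⟩ := Finset.card_eq_two.mp (Finset.card_univ.trans hobj)
  have hall : ∀ a : G, a = u ∨ a = v := fun a => by
    have := Finset.mem_univ a
    rw [huniv] at this
    simpa using this
  simp only [Fintype.card_sigma, huniv, Finset.sum_pair huv] at hcard
  have hu : 0 < Fintype.card (u ⟶ u) := Fintype.card_pos_iff.mpr ⟨𝟙 u⟩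
  have hv : 0 < Fintype.card (v ⟶ v) := Fintype.card_pos_iff.mpr ⟨𝟙 v⟩
  by_cases hne : Nonempty (u ⟶ v)
  · obtain ⟨f⟩ := hne
    let i : u ≅ v := (Groupoid.isoEquivHom u v).symm f
    have h1 : Fintype.card (u ⟶ u) = Fintype.card (u ⟶ v) :=
      Fintype.card_congr (Iso.homCongr (Iso.refl u) i)
    have h2 : Fintype.card (u ⟶ u) = Fintype.card (v ⟶ u) :=
      Fintype.card_congr (Iso.homCongr i (Iso.refl u))
    have h3 : Fintype.card (u ⟶ u) = Fintype.card (v ⟶ v) :=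
      Fintype.card_congr (Iso.homCongr i i)
    refine ⟨u, v, huv, Or.inr (Or.inr ⟨by omega, by omega, ?_⟩)⟩
    intro a b
    rcases hall a with rfl | rfl <;> rcases hall b with rfl | rfl <;> omega
  · have h1 : Fintype.card (u ⟶ v) = 0 :=
      Fintype.card_eq_zero_iff.mpr (not_nonempty_iff.mp hne)
    have h2 : Fintype.card (v ⟶ u) = 0 :=
      Fintype.card_eq_zero_iff.mpr ⟨fun g => hne ⟨Groupoid.inv g⟩⟩
    have hn : ¬ ∀ a b : G, Fintype.card (a ⟶ b) = 1 := fun h => by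
      have := h u v
      omega
    have hc : Fintype.card (u ⟶ u) = 1 ∨ Fintype.card (u ⟶ u) = 2 ∨
      Fintype.card (u ⟶ u) = 3 := by omega
    rcases hc with hc | hc | hc
    · exact ⟨u, v, huv, Or.inl ⟨by omega, by omega, hn⟩⟩
    · exact ⟨u, v, huv, Or.inr (Or.inl ⟨by omega, by omega, hn⟩)⟩
    · exact ⟨v, u, huv.symm, Or.inl ⟨by omega, by omega, hn⟩⟩
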